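/- Let Σ be an alphabet, w ∈ ℕ⁺, τ = (R₁,…,Rᵣ) a relational vocabulary with arities a₁,…,aᵣ, and φ a first-order sentence over τ. Then there exists a finite automaton B over the alphabet Γ(Σ,w,τ) = B(Σ,w) × B(Σ^{⊗a₁},w) × ⋯ × B(Σ^{⊗aᵣ},w) such that L(B) equals the language associated with D(Σ,w,τ,φ), and consequently, for every finite automaton A over Γ(Σ,w,τ) representing a (Σ,w)-regular-decisional class C of τ-structures, some structure in C satisfies φ if and only if L(A) ∩ L(B) ≠ ∅. -/

import Mathlib

open FirstOrder

/-- A language (set of strings) is regular if it is recognized by a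
deterministic finite automaton with finitely many states. -/
def LangRegular {β : Type} (L : Set (List β)) : Prop :=
  Language.IsRegular (L : Language β)

/-- A `(Σ,w)`-layer: left/right frontiers contained in `{0,…,w−1}`, a set of
transitions labelled by symbols of `Σ` or the padding symbol (`none`), sets of
initial and final states, and two boolean flags. -/
structure Layer (σ : Type) (w : ℕ) where
  left : Set (Fin w)
  right : Set (Fin w)
  trans : Set (Fin w × Option σ × Fin w)
  initial : Set (Fin w)
  final : Set (Fin w)
  ini : Bool
  fin : Bool
  trans_mem : ∀ t ∈ trans, t.1 ∈ left ∧ t.2.2 ∈ right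
  initial_sub : initial ⊆ left
  final_sub : final ⊆ right
  initial_empty : ini = false → initial = ∅
  final_empty : fin = false → final = ∅

instance {σ : Type} {w : ℕ} : Inhabited (Layer σ w) :=
  ⟨{ left := ∅, right := ∅, trans := ∅, initial := ∅, final := ∅,
     ini := false, fin := false,
     trans_mem := by simp, initial_sub := by simp, final_sub := by simp,
     initial_empty := fun _ => rfl, final_empty := fun _ => rfl }⟩

/-- A string of layers is a `(Σ,w)`-ODD: it is non-empty, consecutive frontiers
match, the initial flag is set exactly on the first layer, and the final flag is
set exactly on the last layer. -/
def IsODD {σ : Type} {w : ℕ} (D : List (Layer σ w)) : Prop :=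
  D ≠ [] ∧
  (∀ i : ℕ, (h : i + 1 < D.length) →
    (D[i + 1]'h).left = (D[i]'(by omega)).right) ∧
  (∀ i : ℕ, (h : i < D.length) →
    ((D[i]'h).ini = true ↔ i = 0) ∧ ((D[i]'h).fin = true ↔ i = D.length - 1))

/-- Acceptance of a (non-empty) string `s` of length at most `|D|` by the ODD `D`:
there is a sequence of compatible transitions, reading the symbols of `s` followed
by padding symbols, from an initial state of the first layer to a final state of
the last layer. -/
def OddAccepts {σ : Type} {w : ℕ} (D : List (Layer σ w)) (s : List σ) : Prop :=
  s ≠ [] ∧ s.length ≤ D.length ∧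
  ∃ st : ℕ → Fin w,
    (∀ i : ℕ, (h : i < D.length) → (st i, s[i]?, st (i + 1)) ∈ (D[i]'h).trans) ∧
    ∀ h : 0 < D.length,
      st 0 ∈ (D[0]'h).initial ∧ st D.length ∈ (D[D.length - 1]'(by omega)).final

/-- The language of an ODD. -/
def OddLang {σ : Type} {w : ℕ} (D : List (Layer σ w)) : Set (List σ) :=
  { s | OddAccepts D s }

/-- Convolution (tensor product) of a family of strings over (possibly different)
alphabets: the string of length `max_i |u_i|` whose `j`-th symbol has `i`-th
component the `j`-th symbol of `u_i` if `j < |u_i|`, and the padding symbol `none`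
otherwise. -/
def convD {a : ℕ} {α : Fin a → Type} (us : ∀ i, List (α i)) :
    List (∀ i, Option (α i)) :=
  List.ofFn fun j : Fin (Finset.univ.sup fun i => (us i).length) =>
    fun i => (us i)[(j : ℕ)]?

/-- A relation of tuples of strings is regular if its associated language, the set
of convolutions of its tuples, is a regular language. -/
def RegularRelD {a : ℕ} {α : Fin a → Type} (R : Set (∀ i, List (α i))) : Prop :=
  LangRegular { x | ∃ us ∈ R, convD us = x }

/-- Convolution of a pair of strings over two alphabets. -/
def conv2 {α β : Type} (u : List α) (v : List β) : List (Option α × Option β) :=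
  List.ofFn fun j : Fin (max u.length v.length) => (u[(j : ℕ)]?, v[(j : ℕ)]?)

/-- A binary relation of strings is regular if its associated language is regular. -/
def Regular2 {α β : Type} (R : Set (List α × List β)) : Prop :=
  LangRegular { x | ∃ p ∈ R, conv2 p.1 p.2 = x }

/-- Convolution of an `(a+1)`-tuple of strings `(u, v₁, …, vₐ)` where `u` is over
the alphabet `α` and the `v`s over the alphabet `β`. -/
def conv1a {α β : Type} {a : ℕ} (u : List α) (vs : Fin a → List β) :
    List (Option α × (Fin a → Option β)) :=
  List.ofFn fun j : Fin (max u.length (Finset.univ.sup fun i => (vs i).length)) =>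
    (u[(j : ℕ)]?, fun i => (vs i)[(j : ℕ)]?)

/-- An `(a+1)`-ary relation whose first coordinate is a string over `α` and whose
remaining `a` coordinates are strings over `β` is regular if its associated
language of convolutions is regular. -/
def Regular1a {α β : Type} {a : ℕ} (R : Set (List α × (Fin a → List β))) : Prop :=
  LangRegular { x | ∃ p ∈ R, conv1a p.1 p.2 = x }

/-- The `a`-fold tensor product `L^{⊗a}` of a language `L`. -/
def tensorLang {σ : Type} {a : ℕ} (L : Set (List σ)) :
    Set (List (Fin a → Option σ)) :=
  { x | ∃ us : Fin a → List σ, (∀ i, us i ∈ L) ∧ convD us = x }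

/-- The purely relational first-order vocabulary with `r` relation symbols of
arities `ar 0, …, ar (r-1)`. -/
def vocLang (r : ℕ) (ar : Fin r → ℕ) : FirstOrder.Language :=
  { Functions := fun _ => Empty, Relations := fun n => { i : Fin r // ar i = n } }

/-- A tuple `(D₀, D₁, …, Dᵣ)` is `(Σ,w,τ)`-structural: all ODDs have a common
length, `D₀` is over `Σ`, `Dᵢ` is over `Σ^{⊗aᵢ}` (with padding components), and
`L(Dᵢ) ⊆ L(D₀)^{⊗aᵢ}`. -/
def IsStructural {σ : Type} {w r : ℕ} {ar : Fin r → ℕ}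
    (D₀ : List (Layer σ w))
    (Ds : ∀ i : Fin r, List (Layer (Fin (ar i) → Option σ) w)) : Prop :=
  IsODD D₀ ∧
  ∀ i : Fin r, IsODD (Ds i) ∧ (Ds i).length = D₀.length ∧
    OddLang (Ds i) ⊆ tensorLang (OddLang D₀)

/-- The `τ`-structure derived from a structural tuple: its domain is `L(D₀)` and
the `i`-th relation holds of `(u₁,…,u_{aᵢ})` iff `u₁⊗⋯⊗u_{aᵢ} ∈ L(Dᵢ)`. -/
def derivedStr {σ : Type} {w r : ℕ} {ar : Fin r → ℕ}
    (D₀ : List (Layer σ w))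
    (Ds : ∀ i : Fin r, List (Layer (Fin (ar i) → Option σ) w)) :
    (vocLang r ar).Structure { s : List σ // s ∈ OddLang D₀ } where
  funMap := fun f _ => f.elim
  RelMap := fun {n} Rl x =>
    match Rl with
    | ⟨i, h⟩ =>
      convD (fun m : Fin (ar i) => (x (Fin.cast h m)).val) ∈ OddLang (Ds i)

/-- The type of `(r+1)`-tuples of ODDs `(D₀, D₁, …, Dᵣ)`. -/
def StructTuple (σ : Type) (w r : ℕ) (ar : Fin r → ℕ) : Type :=
  List (Layer σ w) × ((i : Fin r) → List (Layer (Fin (ar i) → Option σ) w))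

/-- Convolution of an `(r+1)`-tuple of ODDs. -/
def convTuple {σ : Type} {w r : ℕ} {ar : Fin r → ℕ} (q : StructTuple σ w r ar) :
    List (Option (Layer σ w) ×
      ((i : Fin r) → Option (Layer (Fin (ar i) → Option σ) w))) :=
  List.ofFn fun j : Fin (max q.1.length (Finset.univ.sup fun i => (q.2 i).length)) =>
    (q.1[(j : ℕ)]?, fun i => (q.2 i)[(j : ℕ)]?)

/-- A set of `(r+1)`-tuples of ODDs is regular if its associated language of
convolutions is regular. -/
def RegularTuple {σ : Type} {w r : ℕ} {ar : Fin r → ℕ}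
    (R : Set (StructTuple σ w r ar)) : Prop :=
  LangRegular { x | ∃ q ∈ R, convTuple q = x }

/-- The type of `(r+1+p)`-tuples `(D₀, D₁, …, Dᵣ, v₁, …, v_p)`. -/
def StructTupleV (σ : Type) (w r : ℕ) (ar : Fin r → ℕ) (p : ℕ) : Type :=
  StructTuple σ w r ar × (Fin p → List σ)

/-- Convolution of an `(r+1+p)`-tuple `(D₀, D₁, …, Dᵣ, v₁, …, v_p)`. -/
def convStruct {σ : Type} {w r : ℕ} {ar : Fin r → ℕ} {p : ℕ}
    (q : StructTupleV σ w r ar p) :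
    List ((Option (Layer σ w) ×
        ((i : Fin r) → Option (Layer (Fin (ar i) → Option σ) w))) ×
      (Fin p → Option σ)) :=
  List.ofFn fun j : Fin (max (max q.1.1.length
      (Finset.univ.sup fun i => (q.1.2 i).length))
      (Finset.univ.sup fun t => (q.2 t).length)) =>
    ((q.1.1[(j : ℕ)]?, fun i => (q.1.2 i)[(j : ℕ)]?), fun t => (q.2 t)[(j : ℕ)]?)

/-- A set of `(r+1+p)`-tuples is regular if its associated language of
convolutions is regular. -/
def RegularStruct {σ : Type} {w r : ℕ} {ar : Fin r → ℕ} {p : ℕ}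
    (R : Set (StructTupleV σ w r ar p)) : Prop :=
  LangRegular { x | ∃ q ∈ R, convStruct q = x }

/-- The alphabet `Γ(Σ,w,τ) = B(Σ,w) × B(Σ^{⊗a₁},w) × ⋯ × B(Σ^{⊗aᵣ},w)`. -/
def Gamma (σ : Type) (w r : ℕ) (ar : Fin r → ℕ) : Type :=
  Layer σ w × ((i : Fin r) → Layer (Fin (ar i) → Option σ) w)

/-- Decoding a string over `Γ(Σ,w,τ)` as an `(r+1)`-tuple of strings of layers. -/
def decodeStr {σ : Type} {w r : ℕ} {ar : Fin r → ℕ} (x : List (Gamma σ w r ar)) :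
    StructTuple σ w r ar :=
  (x.map Prod.fst, fun i => x.map fun g => g.2 i)

/-- The string over `Γ(Σ,w,τ)` associated with an `(r+1)`-tuple of ODDs of a
common length (its tensor product, which is padding-free). -/
def tupleStr {σ : Type} {w r : ℕ} {ar : Fin r → ℕ} (q : StructTuple σ w r ar) :
    List (Gamma σ w r ar) :=
  List.ofFn fun j : Fin q.1.length =>
    (q.1[(j : ℕ)]'j.isLt, fun i => ((q.2 i)[(j : ℕ)]?).getD default)

/-- A predicate on strings is regular if the language of strings satisfying it is. -/
def RegularPred {α : Type} (P : List α → Prop) : Prop :=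
  LangRegular { x | P x }

namespace RegularPred

variable {α β : Type} {P Q : List α → Prop}

theorem of_iff (h : RegularPred P) (e : ∀ x, Q x ↔ P x) : RegularPred Q := by
  rwa [show Q = P from funext fun x => propext (e x)]

theorem not (h : RegularPred P) : RegularPred fun x => ¬ P x :=
  Language.IsRegular.compl h

theorem and (h : RegularPred P) (h' : RegularPred Q) : RegularPred fun x => P x ∧ Q x :=
  Language.IsRegular.inf h h'

theorem imp (h : RegularPred P) (h' : RegularPred Q) : RegularPred fun x => P x → Q x :=
  (h.and h'.not).not.of_iff fun x => by tauto

theorem comap (h : RegularPred P) (f : β → α) : RegularPred fun y => P (y.map f) := by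
  obtain ⟨S, hS, M, hM⟩ := h
  refine ⟨S, hS, M.comap f, ?_⟩
  rw [DFA.accepts_comap, hM]
  rfl

/-- Regular predicates are closed under letter-to-letter projections. -/
theorem exists_map (h : RegularPred P) (f : α → β) :
    RegularPred fun y => ∃ x, x.map f = y ∧ P x := by
  obtain ⟨S, hS, M, hM⟩ := h
  let N : NFA β S :=
    { step := fun s b => { t | ∃ a, f a = b ∧ M.step s a = t }
      start := {M.start}
      accept := M.accept }
  have key : ∀ (y : List β) (U : Set S),
      y ∈ N.acceptsFrom U ↔ ∃ s ∈ U, ∃ x, x.map f = y ∧ M.evalFrom s x ∈ M.accept := by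
    intro y
    induction y with
    | nil => intro U; simp [NFA.nil_mem_acceptsFrom, N]
    | cons b y ih =>
      intro U
      rw [NFA.cons_mem_acceptsFrom, ih]
      constructor
      · rintro ⟨t, ht, x, rfl, hx⟩
        obtain ⟨s, hs, a, rfl, rfl⟩ := NFA.mem_stepSet.1 ht
        exact ⟨s, hs, a :: x, rfl, hx⟩
      · rintro ⟨s, hs, _ | ⟨a, x⟩, hxy, hx⟩
        · simp at hxy
        · obtain ⟨rfl, rfl⟩ := List.cons.inj hxy
          exact ⟨M.step s a, NFA.mem_stepSet.2 ⟨s, hs, a, rfl, rfl⟩, x, rfl, hx⟩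
  classical
  refine ⟨Set S, inferInstance, N.toDFA, ?_⟩
  rw [NFA.toDFA_correct, NFA.accepts_eq_acceptsFrom_start]
  ext y
  rw [key]
  have hP : ∀ x, M.evalFrom M.start x ∈ M.accept ↔ P x := fun x => Set.ext_iff.1 hM x
  simp only [N, Set.mem_singleton_iff, exists_eq_left, hP]
  rfl

theorem const (p : Prop) : RegularPred fun _ : List α => p :=
  ⟨Unit, inferInstance, ⟨fun _ _ => (), (), { _s | p }⟩, rfl⟩

theorem forall_fin {n : ℕ} {R : Fin n → List α → Prop} (h : ∀ i, RegularPred (R i)) :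
    RegularPred fun x => ∀ i, R i x := by
  induction n with
  | zero => exact (const True).of_iff fun x => by simp
  | succ n ih =>
    exact ((h 0).and (ih fun i => h i.succ)).of_iff fun x => Fin.forall_fin_succ

/-- The existence of an accepting run of a finite nondeterministic automaton is regular. -/
theorem exists_run {K : Type} [Finite K] (I F : K → Prop) (T : K → α → K → Prop) :
    RegularPred fun x => ∃ st : ℕ → K, I (st 0) ∧ F (st x.length) ∧
      ∀ i, (h : i < x.length) → T (st i) x[i] (st (i + 1)) := by
  let N : NFA α K :=
    { step := fun s a => { t | T s a t }
      start := { s | I s }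
      accept := { s | F s } }
  have key : ∀ (x : List α) (U : Set K), x ∈ N.acceptsFrom U ↔
      ∃ st : ℕ → K, st 0 ∈ U ∧ F (st x.length) ∧
        ∀ i, (h : i < x.length) → T (st i) x[i] (st (i + 1)) := by
    intro x
    induction x with
    | nil =>
      intro U
      rw [NFA.nil_mem_acceptsFrom]
      constructor
      · rintro ⟨s, hs, hF⟩
        exact ⟨fun _ => s, hs, hF, by simp⟩
      · rintro ⟨st, hs, hF, -⟩
        exact ⟨st 0, hs, hF⟩
    | cons a x ih =>
      intro U
      rw [NFA.cons_mem_acceptsFrom, ih]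
      constructor
      · rintro ⟨st, h0, hF, hT⟩
        obtain ⟨s, hs, hst⟩ := NFA.mem_stepSet.1 h0
        refine ⟨fun i => Nat.casesOn i s st, hs, hF, ?_⟩
        rintro (_ | i) h
        · exact hst
        · exact hT i (by simpa using h)
      · rintro ⟨st, h0, hF, hT⟩
        refine ⟨fun i => st (i + 1), NFA.mem_stepSet.2 ⟨st 0, h0, ?_⟩, hF, fun i h => ?_⟩
        · exact hT 0 (by simp)
        · exact hT (i + 1) (by simpa using h)
  classical
  have := Fintype.ofFinite K
  refine ⟨Set K, inferInstance, N.toDFA, ?_⟩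
  rw [NFA.toDFA_correct, NFA.accepts_eq_acceptsFrom_start]
  ext x
  exact key x _

/-- A variant of `RegularPred.exists_run` for non-empty strings in which the conditions on the
first and the last state may depend on the first and the last letter. -/
theorem exists_run_of_ne_nil {K : Type} [Finite K] (I F : α → K → Prop)
    (T : K → α → K → Prop) :
    RegularPred fun x => ∃ h0 : 0 < x.length, ∃ st : ℕ → K,
      I x[0] (st 0) ∧ F (x[x.length - 1]) (st x.length) ∧
      ∀ i, (h : i < x.length) → T (st i) x[i] (st (i + 1)) := by
  refine (exists_run (K := K × Prop × Prop) (fun q => ¬ q.2.1) (fun q => q.2.1 ∧ q.2.2)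
    (fun q a q' => T q.1 a q'.1 ∧ (¬ q.2.1 → I a q.1) ∧ q'.2.1 ∧
      (q'.2.2 ↔ F a q'.1))).of_iff fun x => ?_
  constructor
  · rintro ⟨h0, st, hI, hF, hT⟩
    refine ⟨fun i => (st i, 0 < i, ∃ h : i - 1 < x.length, F x[i - 1] (st i)), by simp,
      ⟨h0, by omega, hF⟩, fun i h => ⟨hT i h, ?_, by simp, ?_⟩⟩
    · intro hi
      obtain rfl : i = 0 := by simpa using hi
      exact hI
    · simp [h]
  · rintro ⟨st, hI, ⟨hF, hF'⟩, hT⟩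
    have h0 : 0 < x.length := by
      rcases Nat.eq_zero_or_pos x.length with h | h
      · rw [h] at hF
        exact absurd hF hI
      · exact h
    refine ⟨h0, fun i => (st i).1, (hT 0 h0).2.1 hI, ?_, fun i h => (hT i h).1⟩
    obtain ⟨-, -, -, h⟩ := hT (x.length - 1) (by omega)
    rw [Nat.sub_add_cancel h0] at h
    exact h.1 hF'

/-- Letterwise conditions are regular. -/
theorem forall_getElem (p : α → Prop) :
    RegularPred fun x => ∀ i, (h : i < x.length) → p x[i] :=
  (exists_run (K := Unit) (fun _ => True) (fun _ => True) (fun _ a _ => p a)).of_iff fun x => by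
    simp

end RegularPred

/-- `t` is the string `u` followed by padding symbols. -/
def PadsTo {σ : Type} (t : List (Option σ)) (u : List σ) : Prop :=
  u.length ≤ t.length ∧ ∀ i, (h : i < t.length) → t[i] = u[i]?

theorem PadsTo.eq {σ : Type} {t : List (Option σ)} {u v : List σ} (hu : PadsTo t u)
    (hv : PadsTo t v) : u = v := by
  refine List.ext_getElem? fun i => ?_
  by_cases h : i < t.length
  · rw [← hu.2 i h, hv.2 i h]
  · have := hu.1
    have := hv.1
    rw [List.getElem?_eq_none (by omega), List.getElem?_eq_none (by omega)]

theorem padsTo_filterMap {σ : Type} (t : List (Option σ))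
    (ht : ∀ i, (h : i + 1 < t.length) → t[i + 1].isSome → t[i].isSome) :
    PadsTo t (t.filterMap id) := by
  refine ⟨List.length_filterMap_le _ _, ?_⟩
  induction t with
  | nil => simp
  | cons a t ih =>
    have ih := ih fun i h => ht (i + 1) (by simpa using h)
    cases a with
    | some a =>
      rintro (_ | i) h
      · simp
      · simpa using ih i (by simpa using h)
    | none =>
      have hnone : ∀ i, (h : i < (none :: t).length) → (none :: t)[i] = none := by
        intro i
        induction i with
        | zero => simp
        | succ i IH =>
          intro h
          by_contra hc
          have := ht i h (Option.isSome_iff_ne_none.2 hc)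
          rw [IH (by omega)] at this
          simp at this
      have hnil : (none :: t).filterMap id = [] := by
        rw [List.filterMap_eq_nil_iff]
        intro o ho
        obtain ⟨i, h, rfl⟩ := List.getElem_of_mem ho
        exact hnone i h
      intro i h
      rw [hnil, hnone i h]
      simp

/-- Acceptance of a padded string by a diagram is a regular property of the pair. -/
theorem regularPred_oddAccepts {σ : Type} {w : ℕ} :
    RegularPred fun z : List (Layer σ w × Option σ) =>
      ∃ u, PadsTo (z.map Prod.snd) u ∧ OddAccepts (z.map Prod.fst) u := by
  refine (RegularPred.exists_run_of_ne_nil (K := Fin w × Prop)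
    (fun a q => q.1 ∈ a.1.initial ∧ q.2 ∧ a.2.isSome) (fun a q => q.1 ∈ a.1.final)
    (fun q a q' => (q.1, a.2, q'.1) ∈ a.1.trans ∧ (a.2.isSome → q.2) ∧
      (q'.2 ↔ a.2.isSome))).of_iff fun z => ?_
  constructor
  · rintro ⟨u, ⟨hlen, hpad⟩, hne, -, st, hst, hIF⟩
    simp only [List.length_map, List.getElem_map] at hlen hpad hst hIF
    have hu : 0 < u.length := List.length_pos_iff.2 hne
    have h0 : 0 < z.length := by omega
    refine ⟨h0, fun i => (st i, i ≤ u.length), ⟨(hIF h0).1, by simp, ?_⟩, (hIF h0).2,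
      fun i h => ⟨?_, ?_, ?_⟩⟩
    · simp [hpad 0 h0, hu]
    · rw [hpad i h]
      exact hst i h
    · rw [hpad i h]
      intro hs
      exact le_of_lt (by simpa using hs : i < u.length)
    · rw [hpad i h]
      simp
  · rintro ⟨h0, st, ⟨hI, -, hI'⟩, hF, hT⟩
    have hpad := padsTo_filterMap (z.map Prod.snd) fun i h hs => by
      simp only [List.length_map, List.getElem_map] at h hs ⊢
      exact (hT i (by omega)).2.2.1 ((hT (i + 1) h).2.1 hs)
    refine ⟨_, hpad, ?_, by simpa using hpad.1, fun i => (st i).1, fun i h => ?_,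
      fun h => ⟨?_, ?_⟩⟩
    · intro hnil
      have := hpad.2 0 (by simpa using h0)
      rw [hnil] at this
      simp only [List.getElem_map] at this
      rw [this] at hI'
      simp at hI'
    · have := hpad.2 i (by simpa using h)
      rw [← this]
      simpa using (hT i (by simpa using h)).1
    · simpa using hI
    · simpa using hF

/-- Being an ODD is a regular property of strings of layers. -/
theorem regularPred_isODD {σ : Type} {w : ℕ} :
    RegularPred fun D : List (Layer σ w) => IsODD D := by
  refine (RegularPred.exists_run_of_ne_nil (K := Set (Fin w) × Prop × Prop)
    (fun _ q => q.2.1) (fun _ q => q.2.2)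
    (fun q a q' => a.left = q.1 ∧ a.right = q'.1 ∧ (a.ini = true ↔ q.2.1) ∧ ¬ q'.2.1 ∧
      (a.fin = true ↔ q'.2.2) ∧ ¬ q.2.2)).of_iff fun D => ?_
  constructor
  · rintro ⟨hne, hadj, hflag⟩
    have h0 : 0 < D.length := List.length_pos_iff.2 hne
    refine ⟨h0, fun i => (if h : i < D.length then D[i].left else D[D.length - 1].right,
      i = 0, i = D.length), rfl, rfl, fun i h => ⟨by simp [h], ?_, (hflag i h).1, by simp,
      (hflag i h).2.trans ?_, ?_⟩⟩
    · by_cases h' : i + 1 < D.length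
      · simp [h', hadj i h']
      · obtain rfl : i = D.length - 1 := by omega
        simp [h']
    · show _ ↔ i + 1 = D.length
      omega
    · exact h.ne
  · rintro ⟨h0, st, hI, hF, hT⟩
    refine ⟨List.length_pos_iff.1 h0, fun i h => ?_, fun i h => ⟨?_, ?_⟩⟩
    · rw [(hT (i + 1) h).1, (hT i (by omega)).2.1]
    · rw [(hT i h).2.2.1]
      constructor
      · intro hi
        by_contra hne
        obtain ⟨j, rfl⟩ := Nat.exists_eq_succ_of_ne_zero hne
        exact (hT j (by omega)).2.2.2.1 hi
      · rintro rfl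
        exact hI
    · rw [(hT i h).2.2.2.2.1]
      constructor
      · intro hi
        by_contra hne
        exact (hT (i + 1) (by omega)).2.2.2.2.2 hi
      · rintro rfl
        rwa [Nat.sub_add_cancel h0]

open Classical in
/-- A tuple of letters as a letter of a convolution; a tuple of padding symbols is padding. -/
noncomputable def joinLetter {σ : Type} {a : ℕ} (f : Fin a → Option σ) :
    Option (Fin a → Option σ) :=
  if ∀ m, f m = none then none else some f

theorem padsTo_convD {σ A : Type} {a : ℕ} {z : List A} {f : A → Fin a → Option σ}
    {us : Fin a → List σ} (h : ∀ m, PadsTo (z.map fun c => f c m) (us m)) :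
    PadsTo (z.map fun c => joinLetter (f c)) (convD us) := by
  constructor
  · simp only [convD, List.length_ofFn, List.length_map, Finset.sup_le_iff]
    exact fun m _ => by simpa using (h m).1
  · intro i hi
    have hf : f (z[i]'(by simpa using hi)) = fun m => (us m)[i]? :=
      funext fun m => by
        have := (h m).2 i (by simpa using hi)
        rwa [List.getElem_map] at this
    simp only [List.getElem_map, hf, joinLetter, convD, List.getElem?_ofFn, Finset.lt_sup_iff]
    by_cases hc : ∃ m, i < (us m).length
    · simp [hc]
    · simp only [not_exists, not_lt] at hc
      simp [hc]

section Encoding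

variable {σ : Type} {w r : ℕ} {ar : Fin r → ℕ} {n : ℕ}

theorem decodeStr_map_fst {A : Type} (z : List A) (f : A → Gamma σ w r ar) :
    (decodeStr (z.map f)).1 = z.map fun c => (f c).1 :=
  List.map_map

theorem decodeStr_map_snd {A : Type} (z : List A) (f : A → Gamma σ w r ar) (i : Fin r) :
    (decodeStr (z.map f)).2 i = z.map fun c => (f c).2 i :=
  List.map_map

theorem length_decodeStr_fst (x : List (Gamma σ w r ar)) :
    (decodeStr x).1.length = x.length :=
  List.length_map _

theorem length_decodeStr_snd (x : List (Gamma σ w r ar)) (i : Fin r) :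
    ((decodeStr x).2 i).length = x.length :=
  List.length_map _

theorem length_tupleStr (q : StructTuple σ w r ar) : (tupleStr q).length = q.1.length :=
  List.length_ofFn

theorem getElem_tupleStr (q : StructTuple σ w r ar) (j : ℕ) (h : j < (tupleStr q).length) :
    (tupleStr q)[j] = (q.1[j]'(by rwa [length_tupleStr] at h),
      fun i => ((q.2 i)[j]?).getD default) :=
  List.getElem_ofFn _

/-- The domain of the structure derived from a string over `Γ(Σ,w,τ)`. -/
abbrev Dom (x : List (Gamma σ w r ar)) : Type :=
  { s : List σ // s ∈ OddLang (decodeStr x).1 }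

/-- Satisfaction in the structure derived from a string over `Γ(Σ,w,τ)`. -/
def Sat (x : List (Gamma σ w r ar)) (ψ : (vocLang r ar).BoundedFormula Empty n)
    (us : Fin n → Dom x) : Prop :=
  letI := derivedStr (decodeStr x).1 (decodeStr x).2
  ψ.Realize default us

/-- `z` is the string `x` annotated with the padded letters of the assignment `us`. -/
def Encodes (z : List (Gamma σ w r ar × (Fin n → Option σ))) (x : List (Gamma σ w r ar))
    (us : Fin n → Dom x) : Prop :=
  z.map Prod.fst = x ∧ ∀ v, PadsTo (z.map fun c => c.2 v) (us v).1

/-- `z` encodes a string over `Γ(Σ,w,τ)` together with an assignment satisfying `ψ`. -/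
def Holds (ψ : (vocLang r ar).BoundedFormula Empty n)
    (z : List (Gamma σ w r ar × (Fin n → Option σ))) : Prop :=
  ∃ x us, Encodes z x us ∧ Sat x ψ us

theorem Encodes.eq {z : List (Gamma σ w r ar × (Fin n → Option σ))}
    {x : List (Gamma σ w r ar)} {us vs : Fin n → Dom x} (h : Encodes z x us)
    (h' : Encodes z x vs) : us = vs :=
  funext fun v => Subtype.ext ((h.2 v).eq (h'.2 v))

theorem Encodes.holds_iff {z : List (Gamma σ w r ar × (Fin n → Option σ))}
    {x : List (Gamma σ w r ar)} {us : Fin n → Dom x} (h : Encodes z x us)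
    (ψ : (vocLang r ar).BoundedFormula Empty n) : Holds ψ z ↔ Sat x ψ us := by
  refine ⟨?_, fun hs => ⟨x, us, h, hs⟩⟩
  rintro ⟨y, vs, h', hs⟩
  obtain rfl : x = y := h.1.symm.trans h'.1
  rwa [h.eq h']

theorem exists_encodes (x : List (Gamma σ w r ar)) (us : Fin n → Dom x) :
    ∃ z, Encodes z x us := by
  refine ⟨x.mapIdx fun j a => (a, fun v => (us v).1[j]?), ?_, fun v => ⟨?_, fun i h => ?_⟩⟩
  · exact List.ext_getElem (by simp) (by simp)
  · simpa [length_decodeStr_fst] using (us v).2.2.1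
  · simp

theorem Encodes.exists_snoc {z : List (Gamma σ w r ar × (Fin n → Option σ))}
    {x : List (Gamma σ w r ar)} {us : Fin n → Dom x} (h : Encodes z x us) (d : Dom x) :
    ∃ z' : List (Gamma σ w r ar × (Fin (n + 1) → Option σ)),
      (z'.map fun c => (c.1, fun v : Fin n => c.2 v.castSucc)) = z ∧
        Encodes z' x (Fin.snoc us d : Fin (n + 1) → Dom x) := by
  have hlen : z.length = x.length := by rw [← h.1, List.length_map]
  refine ⟨z.mapIdx fun j c => (c.1, (Fin.snoc c.2 d.1[j]? : Fin (n + 1) → Option σ)), ?_, ?_, ?_⟩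
  · exact List.ext_getElem (by simp) (by simp)
  · refine Eq.trans ?_ h.1
    exact List.ext_getElem (by simp) (by simp)
  · intro v
    refine Fin.lastCases ?_ (fun v => ?_) v
    · refine ⟨?_, fun i _ => by simp⟩
      simpa [length_decodeStr_fst, hlen] using d.2.2.1
    · refine ⟨by simpa using (h.2 v).1, fun i hi => ?_⟩
      have := (h.2 v).2 i (by simpa using hi)
      simpa using this

theorem Encodes.castSucc {z : List (Gamma σ w r ar × (Fin (n + 1) → Option σ))}
    {x : List (Gamma σ w r ar)} {us : Fin (n + 1) → Dom x} (h : Encodes z x us) :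
    Encodes (z.map fun c => (c.1, fun v : Fin n => c.2 v.castSucc)) x
      fun v => us v.castSucc := by
  refine ⟨?_, fun v => ?_⟩
  · rw [← h.1, List.map_map]
    rfl
  · rw [List.map_map]
    exact h.2 v.castSucc

theorem regularPred_encodes :
    RegularPred fun z : List (Gamma σ w r ar × (Fin n → Option σ)) =>
      ∃ x us, Encodes z x us := by
  refine (RegularPred.forall_fin fun v : Fin n => regularPred_oddAccepts.comap
    fun c : Gamma σ w r ar × (Fin n → Option σ) => (c.1.1, c.2 v)).of_iff fun z => ?_
  simp only [List.map_map]
  constructor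
  · rintro ⟨x, us, rfl, h⟩ v
    refine ⟨(us v).1, h v, ?_⟩
    have key : ∀ s ∈ OddLang (decodeStr (z.map Prod.fst)).1,
        OddAccepts (z.map fun c => c.1.1) s := fun s hs => by rwa [decodeStr_map_fst] at hs
    exact key _ (us v).2
  · intro h
    choose us hp ho using h
    refine ⟨_, fun v => ⟨us v, ?_⟩, rfl, hp⟩
    rw [decodeStr_map_fst]
    exact ho v

/-- To see that satisfaction of `ψ` is regular, it suffices to find a regular property
expressing it on all strings that encode an assignment. -/
theorem regularPred_holds_of {ψ : (vocLang r ar).BoundedFormula Empty n}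
    {R : List (Gamma σ w r ar × (Fin n → Option σ)) → Prop} (hR : RegularPred R)
    (h : ∀ z x us, Encodes z x us → (Sat x ψ us ↔ R z)) : RegularPred (Holds (σ := σ) (w := w) ψ) := by
  refine (regularPred_encodes.and hR).of_iff fun z => ?_
  constructor
  · rintro ⟨x, us, he, hs⟩
    exact ⟨⟨x, us, he⟩, (h z x us he).1 hs⟩
  · rintro ⟨⟨x, us, he⟩, hr⟩
    exact ⟨x, us, he, (h z x us he).2 hr⟩

theorem vocLang_term_eq_var (t : (vocLang r ar).Term (Empty ⊕ Fin n)) :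
    ∃ v, t = Language.Term.var (Sum.inr v) := by
  rcases t with (e | v) | ⟨f, _⟩
  · exact e.elim
  · exact ⟨v, rfl⟩
  · exact f.elim

/-- For every formula, the strings encoding a structure with a satisfying assignment form a
regular language. -/
theorem regularPred_holds (ψ : (vocLang r ar).BoundedFormula Empty n) :
    RegularPred (Holds (σ := σ) (w := w) ψ) := by
  induction ψ with
  | falsum => exact regularPred_holds_of (RegularPred.const False) fun _ _ _ _ => Iff.rfl
  | equal t₁ t₂ =>
    obtain ⟨v₁, rfl⟩ := vocLang_term_eq_var t₁
    obtain ⟨v₂, rfl⟩ := vocLang_term_eq_var t₂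
    refine regularPred_holds_of (RegularPred.forall_getElem fun c => c.2 v₁ = c.2 v₂)
      fun z x us he => ?_
    change us v₁ = us v₂ ↔ _
    constructor
    · intro h i hi
      have h₁ := (he.2 v₁).2 i (by simpa using hi)
      have h₂ := (he.2 v₂).2 i (by simpa using hi)
      rw [h, ← h₂] at h₁
      simpa using h₁
    · intro h
      refine Subtype.ext ((he.2 v₁).eq ?_)
      rw [show (z.map fun c => c.2 v₁) = z.map fun c => c.2 v₂ from
        List.ext_getElem (by simp) fun i hi _ => by simpa using h i (by simpa using hi)]
      exact he.2 v₂
  | rel R ts =>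
    obtain ⟨i, rfl⟩ := R
    choose v hv using fun m => vocLang_term_eq_var (ts m)
    obtain rfl : ts = fun m => Language.Term.var (Sum.inr (v m)) := funext hv
    refine regularPred_holds_of (regularPred_oddAccepts.comap fun c =>
      (c.1.2 i, joinLetter fun m => c.2 (v m))) fun z x us he => ?_
    have hp := padsTo_convD (z := z) (f := fun c m => c.2 (v m)) fun m => he.2 (v m)
    change OddAccepts ((decodeStr x).2 i) (convD fun m => (us (v m)).1) ↔ _
    simp only [List.map_map, ← congrArg (fun y => (decodeStr y).2 i) he.1, decodeStr_map_snd]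
    constructor
    · exact fun h => ⟨_, hp, h⟩
    · rintro ⟨s, hs, h⟩
      rwa [hp.eq hs]
  | imp ψ₁ ψ₂ ih₁ ih₂ =>
    refine regularPred_holds_of (ih₁.imp ih₂) fun z x us he => ?_
    rw [he.holds_iff, he.holds_iff]
    rfl
  | all ψ ih =>
    refine regularPred_holds_of ((regularPred_encodes.and ih.not).exists_map
      fun c => (c.1, fun v => c.2 v.castSucc)).not fun z x us he => ?_
    change (∀ d, Sat x ψ (Fin.snoc us d)) ↔ _
    constructor
    · rintro h ⟨z', rfl, ⟨y, vs, he'⟩, hn⟩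
      obtain rfl : y = x := he'.castSucc.1.symm.trans he.1
      rw [he'.holds_iff] at hn
      rw [he.eq he'.castSucc] at h
      apply hn
      have := h (vs (Fin.last _))
      rwa [show (Fin.snoc (fun v => vs v.castSucc) (vs (Fin.last _)) : Fin _ → Dom y) = vs
        from Fin.snoc_init_self vs] at this
    · intro h d
      obtain ⟨z', hz, he'⟩ := he.exists_snoc d
      by_contra hc
      exact h ⟨z', hz, ⟨x, _, he'⟩, fun hh => hc ((he'.holds_iff ψ).1 hh)⟩

/-- Containment of the language of a relation diagram in the tensor power of the language of
the domain diagram is regular. -/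
theorem regularPred_subset_tensorLang (i : Fin r) :
    RegularPred fun x : List (Gamma σ w r ar) =>
      OddLang ((decodeStr x).2 i) ⊆ tensorLang (OddLang (decodeStr x).1) := by
  have hA := (regularPred_oddAccepts (w := w)).comap
    fun c : Gamma σ w r ar × Option (Fin (ar i) → Option σ) => (c.1.2 i, c.2)
  have hB := (regularPred_encodes (σ := σ) (w := w) (ar := ar) (n := ar i)).exists_map
    fun c => (c.1, joinLetter c.2)
  refine ((hA.and hB.not).exists_map Prod.fst).not.of_iff fun x => ?_
  constructor
  · rintro h ⟨z, rfl, ⟨s, hp, hs⟩, hn⟩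
    simp only [List.map_map] at hp hs
    obtain ⟨us, hus, rfl⟩ := h (show OddAccepts _ s by
      rwa [decodeStr_map_snd])
    obtain ⟨z', he⟩ := exists_encodes (z.map Prod.fst) fun v => ⟨us v, hus v⟩
    refine hn ⟨z', ?_, _, _, he⟩
    have hlen : z'.length = z.length := by simpa using congrArg List.length he.1
    have hp' := padsTo_convD (z := z') (f := fun c m => c.2 m) fun m => he.2 m
    refine List.ext_getElem (by simp [hlen]) fun j hj hj' => ?_
    have h1 : z'[j].1 = z[j].1 := by
      have := List.getElem_of_eq he.1 (i := j) (by simpa using hj)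
      simpa using this
    have h2 := hp'.2 j (by simpa using hj)
    have h3 := hp.2 j (by simpa using hj')
    simp only [List.getElem_map, Function.comp] at h2 h3 ⊢
    exact Prod.ext h1 (h2.trans h3.symm)
  · intro h s hs
    by_contra hc
    have hs' : OddAccepts (x.map fun g => g.2 i) s := hs
    have hfst : (x.mapIdx fun j a => (a, s[j]?)).map Prod.fst = x :=
      List.ext_getElem (by simp) (by simp)
    have hp : PadsTo ((x.mapIdx fun j a => (a, s[j]?)).map Prod.snd) s :=
      ⟨by simpa using hs'.2.1, fun j _ => by simp⟩
    refine h ⟨_, hfst, ⟨s, ?_, ?_⟩, ?_⟩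
    · rw [List.map_map]
      exact hp
    · rw [← hfst, List.map_map] at hs'
      rw [List.map_map]
      exact hs'
    · rintro ⟨z, hz, y, us, he⟩
      have hy : y = x := by
        rw [← he.1, ← hfst, ← hz, List.map_map]
        rfl
      subst hy
      refine hc ⟨fun v => (us v).1, fun v => (us v).2, ?_⟩
      refine PadsTo.eq ?_ hp
      rw [← hz, List.map_map]
      exact padsTo_convD (z := z) (f := fun c m => c.2 m) fun m => he.2 m

theorem regularPred_isStructural :
    RegularPred fun x : List (Gamma σ w r ar) =>
      IsStructural (decodeStr x).1 (decodeStr x).2 := by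
  refine ((regularPred_isODD.comap Prod.fst).and (RegularPred.forall_fin fun i =>
    (regularPred_isODD.comap fun g => g.2 i).and
      (regularPred_subset_tensorLang i))).of_iff fun x => ?_
  have hlen := fun i => (length_decodeStr_snd x i).trans (length_decodeStr_fst x).symm
  exact ⟨fun h => ⟨h.1, fun i => ⟨(h.2 i).1, (h.2 i).2.2⟩⟩,
    fun h => ⟨h.1, fun i => ⟨(h.2 i).1, hlen i, (h.2 i).2⟩⟩⟩

theorem regularPred_sat (φ : (vocLang r ar).Sentence) :
    RegularPred fun x : List (Gamma σ w r ar) => Sat x φ default := by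
  refine ((regularPred_holds φ).comap fun g => (g, default)).of_iff fun x => ?_
  exact (Encodes.holds_iff ⟨by simp [Function.comp_def], fun v => v.elim0⟩ φ).symm

theorem tupleStr_decodeStr (x : List (Gamma σ w r ar)) : tupleStr (decodeStr x) = x := by
  refine List.ext_getElem ((length_tupleStr _).trans (length_decodeStr_fst x)) fun j h h' => ?_
  rw [getElem_tupleStr]
  refine Prod.ext (List.getElem_map _) (funext fun i => ?_)
  have : ((decodeStr x).2 i)[j]? = some (x[j].2 i) := by
    rw [List.getElem?_eq_getElem (by rwa [length_decodeStr_snd])]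
    exact congrArg some (List.getElem_map _)
  exact congrArg (Option.getD · default) this

theorem decodeStr_tupleStr {q : StructTuple σ w r ar} (hq : ∀ i, (q.2 i).length = q.1.length) :
    decodeStr (tupleStr q) = q := by
  refine Prod.ext ?_ (funext fun i => ?_)
  · refine List.ext_getElem (by rw [length_decodeStr_fst, length_tupleStr]) fun j h h' => ?_
    exact (List.getElem_map _).trans (congrArg Prod.fst (getElem_tupleStr q j _))
  · refine List.ext_getElem (by rw [length_decodeStr_snd, length_tupleStr, hq])
      fun j h h' => ?_
    refine (List.getElem_map _).trans
      ((congrArg (fun g : Gamma σ w r ar => g.2 i) (getElem_tupleStr q j _)).trans ?_)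
    simp [h']

end Encoding

/-- There exists a finite automaton `B` over `Γ(Σ,w,τ)` whose language is the
language associated with `D(Σ,w,τ,φ)`; consequently, for every finite automaton
`A` over `Γ(Σ,w,τ)` representing a `(Σ,w)`-regular-decisional class `C` of
`τ`-structures, some structure in `C` satisfies `φ` iff `L(A) ∩ L(B) ≠ ∅`. -/
theorem stmt19 (σ : Type) [Fintype σ] [Nonempty σ] (w : ℕ) (hw : 0 < w)
    (r : ℕ) (ar : Fin r → ℕ) (har : ∀ i, 0 < ar i)
    (φ : (vocLang r ar).Sentence) :
    ∃ (QB : Type) (_ : Fintype QB) (B : NFA (Gamma σ w r ar) QB),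
      B.accepts = { x : List (Gamma σ w r ar) |
        ∃ q : StructTuple σ w r ar, IsStructural q.1 q.2 ∧
          (letI := derivedStr q.1 q.2
           FirstOrder.Language.Sentence.Realize { s : List σ // s ∈ OddLang q.1 } φ) ∧
          tupleStr q = x } ∧
      ∀ (QA : Type) (_ : Fintype QA) (A : NFA (Gamma σ w r ar) QA)
        (C : Set ((M : Type) × (vocLang r ar).Structure M)),
        (∀ x ∈ A.accepts, IsStructural (decodeStr x).1 (decodeStr x).2) →
        C = { S | ∃ x ∈ A.accepts,
            Nonempty (@FirstOrder.Language.Equiv (vocLang r ar)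
              { s : List σ // s ∈ OddLang (decodeStr x).1 } S.1
              (derivedStr (decodeStr x).1 (decodeStr x).2) S.2) } →
        ((∃ S ∈ C, letI := S.2
            FirstOrder.Language.Sentence.Realize S.1 φ) ↔
          ∃ x, x ∈ A.accepts ∧ x ∈ B.accepts) := by
  have hB : RegularPred fun x : List (Gamma σ w r ar) =>
      IsStructural (decodeStr x).1 (decodeStr x).2 ∧ Sat x φ default :=
    regularPred_isStructural.and (regularPred_sat φ)
  obtain ⟨QB, hQB, M, hM⟩ := hB
  have hmem : ∀ x, x ∈ M.toNFA.accepts ↔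
      IsStructural (decodeStr x).1 (decodeStr x).2 ∧ Sat x φ default := fun x => by
    rw [DFA.toNFA_correct]
    exact Set.ext_iff.1 hM x
  refine ⟨QB, hQB, M.toNFA, ?_, fun QA _ A C hA hC => ?_⟩
  · ext x
    rw [hmem]
    constructor
    · rintro ⟨hs, hφ⟩
      refine ⟨decodeStr x, hs, ?_, tupleStr_decodeStr x⟩
      unfold Sat at hφ
      rwa [Subsingleton.elim default (default : Fin 0 → Dom x)] at hφ
    · rintro ⟨q, hs, hφ, rfl⟩
      obtain ⟨x, rfl⟩ : ∃ x, q = decodeStr x :=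
        ⟨_, (decodeStr_tupleStr fun i => (hs.2 i).2.1).symm⟩
      rw [tupleStr_decodeStr]
      refine ⟨hs, ?_⟩
      unfold Sat
      rwa [Subsingleton.elim default (default : Fin 0 → Dom x)]
  · subst hC
    constructor
    · rintro ⟨S, ⟨x, hx, ⟨e⟩⟩, hS⟩
      let _ := derivedStr (decodeStr x).1 (decodeStr x).2
      let _ := S.2
      exact ⟨x, hx, (hmem x).2 ⟨hA x hx, (Language.StrongHomClass.realize_sentence e φ).2 hS⟩⟩
    · rintro ⟨x, hx, hB⟩
      let S : (M : Type) × (vocLang r ar).Structure M :=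
        ⟨Dom x, derivedStr (decodeStr x).1 (decodeStr x).2⟩
      let _ := S.2
      exact ⟨S, ⟨x, hx, ⟨Language.Equiv.refl _ _⟩⟩, ((hmem x).1 hB).2⟩
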